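/- arXiv:2101.08249 — 3 statements merged into one kernel-verified Lean document; each statement's English description precedes it below -/
import Mathlib

section
/- Let 0 < ε < 1/2, let 𝓝 ⊆ 𝓜_k be an ε-net of 𝓜_k and 𝓝^+ ⊆ 𝓜_k^+ an ε-net of 𝓜_k^+, both with respect to the Frobenius norm. Then for every symmetric n×n matrix A, sup_{M ∈ 𝓜_k^+} ⟨A, M⟩ ≤ sup_{N ∈ 𝓝^+} ⟨A, N⟩ + (2ε/(1 − 2ε)) · sup_{N ∈ 𝓝} ⟨A, N⟩. -/
open Matrix
open scoped BigOperators

noncomputable section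

/-- Frobenius inner product of two square matrices. -/
def finner {n : ℕ} (A B : Matrix (Fin n) (Fin n) ℝ) : ℝ := ∑ i, ∑ j, A i j * B i j

/-- Frobenius norm. -/
def fnorm {n : ℕ} (M : Matrix (Fin n) (Fin n) ℝ) : ℝ := Real.sqrt (finner M M)

open Classical in
/-- `eigDesc A i` is the `(i+1)`-st largest eigenvalue of a symmetric real matrix `A`
(0-indexed, so `eigDesc A 0 = λ_1` is the largest and `eigDesc A (n-1) = λ_n` the smallest);
junk value `0` out of range or for non-symmetric `A`. -/
def eigDesc {n : ℕ} (A : Matrix (Fin n) (Fin n) ℝ) (i : ℕ) : ℝ :=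
  if h : i < n then
    (if hA : A.IsHermitian then
      hA.eigenvalues ((Tuple.sort hA.eigenvalues) (Fin.rev ⟨i, h⟩)) else 0)
  else 0

/-- `singDesc A i` is the `(i+1)`-st largest singular value of `A` (0-indexed). -/
def singDesc {n : ℕ} (A : Matrix (Fin n) (Fin n) ℝ) (i : ℕ) : ℝ :=
  Real.sqrt (eigDesc (Aᵀ * A) i)

/-- `𝓜_k`: the set of `n × n` real matrices of rank at most `k` and Frobenius norm at most 1. -/
def MSet (n k : ℕ) : Set (Matrix (Fin n) (Fin n) ℝ) :=
  {M | M.rank ≤ k ∧ fnorm M ≤ 1}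

/-- `𝓜_k⁺`: the symmetric positive semidefinite members of `𝓜_k`. -/
def MSetPlus (n k : ℕ) : Set (Matrix (Fin n) (Fin n) ℝ) :=
  {M | M ∈ MSet n k ∧ M.PosSemidef}

/-- `𝓝` is an `ε`-net of `S` (w.r.t. the Frobenius norm): `𝓝 ⊆ S` and every point of `S`
is within Frobenius distance `ε` of some point of `𝓝`. -/
def IsNet {n : ℕ} (S N : Set (Matrix (Fin n) (Fin n) ℝ)) (ε : ℝ) : Prop :=
  N ⊆ S ∧ ∀ M ∈ S, ∃ N' ∈ N, fnorm (M - N') ≤ ε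

theorem finner_add_right {n : ℕ} (A B C : Matrix (Fin n) (Fin n) ℝ) :
    finner A (B + C) = finner A B + finner A C := by
  simp [finner, mul_add, Finset.sum_add_distrib]

theorem finner_smul_right {n : ℕ} (A B : Matrix (Fin n) (Fin n) ℝ) (c : ℝ) :
    finner A (c • B) = c * finner A B := by
  simp [finner, Finset.mul_sum, mul_left_comm]

theorem finner_smul_left {n : ℕ} (A B : Matrix (Fin n) (Fin n) ℝ) (c : ℝ) :
    finner (c • A) B = c * finner A B := by
  simp [finner, Finset.mul_sum, mul_assoc]

theorem fnorm_smul {n : ℕ} (A : Matrix (Fin n) (Fin n) ℝ) (c : ℝ) :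
    fnorm (c • A) = |c| * fnorm A := by
  rw [fnorm, finner_smul_left, finner_smul_right, ← mul_assoc,
    Real.sqrt_mul (mul_self_nonneg c), Real.sqrt_mul_self_eq_abs, fnorm]

theorem two_mul_finner_le {n : ℕ} (A B : Matrix (Fin n) (Fin n) ℝ) :
    2 * finner A B ≤ finner A A + finner B B := by
  simp only [finner, Finset.mul_sum, ← Finset.sum_add_distrib]
  gcongr with i _ j _
  nlinarith [sq_nonneg (A i j - B i j)]

theorem finner_self_eq_sum_norm_sq {n : ℕ} (M : Matrix (Fin n) (Fin n) ℝ) :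
    finner M M = ∑ j, ‖toEuclideanLin M (EuclideanSpace.single j 1)‖ ^ 2 := by
  rw [finner, Finset.sum_comm]
  simp [EuclideanSpace.norm_sq_eq, ← pow_two]

theorem fnorm_symm_toEuclideanLin_comp_le {n : ℕ} (M : Matrix (Fin n) (Fin n) ℝ)
    (P : EuclideanSpace ℝ (Fin n) →ₗ[ℝ] EuclideanSpace ℝ (Fin n)) (hP : ∀ x, ‖P x‖ ≤ ‖x‖) :
    fnorm (toEuclideanLin.symm (P ∘ₗ toEuclideanLin M)) ≤ fnorm M := by
  refine Real.sqrt_le_sqrt ?_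
  simp only [finner_self_eq_sum_norm_sq, LinearEquiv.apply_symm_apply, LinearMap.comp_apply]
  gcongr
  exact hP _

theorem rank_eq_finrank_range_toEuclideanLin {n : ℕ} (M : Matrix (Fin n) (Fin n) ℝ) :
    M.rank = Module.finrank ℝ (LinearMap.range (toEuclideanLin M)) :=
  M.rank_eq_finrank_range_toLin (PiLp.basisFun 2 ℝ (Fin n)) (PiLp.basisFun 2 ℝ (Fin n))

theorem rank_sub_le_add_rank {n : ℕ} (A B : Matrix (Fin n) (Fin n) ℝ) :
    (A - B).rank ≤ A.rank + B.rank := by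
  simp only [rank_eq_finrank_range_toEuclideanLin]
  refine (Submodule.finrank_mono ?_).trans (Submodule.finrank_add_le_finrank_add_finrank _ _)
  rintro _ ⟨x, rfl⟩
  rw [map_sub, LinearMap.sub_apply]
  exact Submodule.sub_mem _ (Submodule.mem_sup_left (LinearMap.mem_range_self _ x))
    (Submodule.mem_sup_right (LinearMap.mem_range_self _ x))

theorem exists_submodule_le_finrank_eq {E : Type*} [AddCommGroup E] [Module ℝ E]
    (V : Submodule ℝ E) [FiniteDimensional ℝ V] {m : ℕ} (hm : m ≤ Module.finrank ℝ V) :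
    ∃ W ≤ V, Module.finrank ℝ W = m := by
  let b := Module.finBasis ℝ V
  let f : Fin m → E := fun i => b (Fin.castLE hm i)
  have hf : LinearIndependent ℝ f :=
    (b.linearIndependent.map' V.subtype V.ker_subtype).comp _ (Fin.castLE_injective hm)
  refine ⟨Submodule.span ℝ (Set.range f), Submodule.span_le.2 ?_, ?_⟩
  · rintro _ ⟨i, rfl⟩
    exact (b _).2
  · simpa using finrank_span_eq_card hf

/-- A matrix of rank at most `2k` is the sum of two matrices of rank at most `k`, neither of
which has larger Frobenius norm. -/
theorem exists_add_eq_of_rank_le_two_mul {n k : ℕ} (D : Matrix (Fin n) (Fin n) ℝ)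
    (hD : D.rank ≤ 2 * k) :
    ∃ B C : Matrix (Fin n) (Fin n) ℝ, B + C = D ∧ (B.rank ≤ k ∧ fnorm B ≤ fnorm D) ∧
      (C.rank ≤ k ∧ fnorm C ≤ fnorm D) := by
  rw [rank_eq_finrank_range_toEuclideanLin] at hD
  set V := LinearMap.range (toEuclideanLin D) with hV
  obtain ⟨W, hWV, hW⟩ := exists_submodule_le_finrank_eq V (min_le_right k (Module.finrank ℝ V))
  have hsum := Submodule.finrank_add_inf_finrank_orthogonal hWV
  refine ⟨toEuclideanLin.symm (W.starProjection.toLinearMap ∘ₗ toEuclideanLin D),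
    toEuclideanLin.symm (Wᗮ.starProjection.toLinearMap ∘ₗ toEuclideanLin D), ?_,
    ⟨?_, fnorm_symm_toEuclideanLin_comp_le _ _ W.norm_starProjection_apply_le⟩,
    ⟨?_, fnorm_symm_toEuclideanLin_comp_le _ _ Wᗮ.norm_starProjection_apply_le⟩⟩
  · rw [← map_add, LinearEquiv.symm_apply_eq]
    ext1 x
    simp [Submodule.starProjection_orthogonal_val]
  · rw [rank_eq_finrank_range_toEuclideanLin, LinearEquiv.apply_symm_apply]
    refine (Submodule.finrank_mono (t := W) ?_).trans (by omega)
    rintro _ ⟨x, rfl⟩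
    exact W.starProjection_apply_mem _
  · rw [rank_eq_finrank_range_toEuclideanLin, LinearEquiv.apply_symm_apply]
    refine (Submodule.finrank_mono (t := Wᗮ ⊓ V) ?_).trans (by omega)
    rintro _ ⟨x, rfl⟩
    refine ⟨Wᗮ.starProjection_apply_mem _, ?_⟩
    have hx : toEuclideanLin D x ∈ V := ⟨x, rfl⟩
    simpa [Submodule.starProjection_orthogonal_val] using
      V.sub_mem hx (hWV (W.starProjection_apply_mem _))

theorem zero_mem_MSetPlus (n k : ℕ) : (0 : Matrix (Fin n) (Fin n) ℝ) ∈ MSetPlus n k :=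
  ⟨⟨by simp, by simp [fnorm, finner]⟩, PosSemidef.zero⟩

theorem bddAbove_finner_MSet (n k : ℕ) (A : Matrix (Fin n) (Fin n) ℝ) :
    BddAbove {r : ℝ | ∃ M ∈ MSet n k, r = finner A M} := by
  refine ⟨(finner A A + 1) / 2, ?_⟩
  rintro _ ⟨M, ⟨-, hM⟩, rfl⟩
  have h := two_mul_finner_le A M
  rw [fnorm, Real.sqrt_le_one] at hM
  linarith

theorem finner_le_mul_sSup_of_rank_le {n k : ℕ} {ε : ℝ} (hε : 0 < ε)
    (A B : Matrix (Fin n) (Fin n) ℝ) (hB : B.rank ≤ k) (hBε : fnorm B ≤ ε) :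
    finner A B ≤ ε * sSup {r : ℝ | ∃ M ∈ MSet n k, r = finner A M} := by
  rw [← inv_mul_le_iff₀ hε, ← finner_smul_right]
  refine le_csSup (bddAbove_finner_MSet n k A) ⟨_, ⟨?_, ?_⟩, rfl⟩
  · rw [rank_eq_finrank_range_toEuclideanLin] at hB ⊢
    rwa [map_smul, LinearMap.range_smul _ _ (inv_ne_zero hε.ne')]
  · rw [fnorm_smul, abs_of_pos (inv_pos.2 hε), inv_mul_le_iff₀ hε]
    simpa using hBε

/-- The supremum of `⟨A, ·⟩` over a subset of `𝓜_k` exceeds that over an `ε`-net by at most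
`2ε` times the supremum over `𝓜_k`. -/
theorem sSup_finner_le_of_isNet {n k : ℕ} {ε : ℝ} (hε : 0 < ε)
    {S N : Set (Matrix (Fin n) (Fin n) ℝ)} (hS : S ⊆ MSet n k) (hne : S.Nonempty)
    (hN : IsNet S N ε) (A : Matrix (Fin n) (Fin n) ℝ) :
    sSup {r : ℝ | ∃ M ∈ S, r = finner A M} ≤ sSup {r : ℝ | ∃ M ∈ N, r = finner A M} +
      2 * ε * sSup {r : ℝ | ∃ M ∈ MSet n k, r = finner A M} := by
  obtain ⟨M₀, hM₀⟩ := hne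
  refine csSup_le ⟨_, M₀, hM₀, rfl⟩ ?_
  rintro _ ⟨M, hM, rfl⟩
  obtain ⟨N', hN', hdist⟩ := hN.2 M hM
  have hrank : (M - N').rank ≤ 2 * k := by
    have h := rank_sub_le_add_rank M N'
    have hMk := (hS hM).1
    have hNk := (hS (hN.1 hN')).1
    omega
  obtain ⟨B, C, hBC, ⟨hB, hBn⟩, hC, hCn⟩ := exists_add_eq_of_rank_le_two_mul _ hrank
  have hM' : M = N' + (B + C) := by rw [hBC]; abel
  have hBle := finner_le_mul_sSup_of_rank_le hε A B hB (hBn.trans hdist)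
  have hCle := finner_le_mul_sSup_of_rank_le hε A C hC (hCn.trans hdist)
  have hNle : finner A N' ≤ sSup {r : ℝ | ∃ M ∈ N, r = finner A M} := by
    refine le_csSup ((bddAbove_finner_MSet n k A).mono ?_) ⟨N', hN', rfl⟩
    rintro _ ⟨L, hL, rfl⟩
    exact ⟨L, hS (hN.1 hL), rfl⟩
  rw [hM', finner_add_right, finner_add_right]
  linarith

/-- Lemma `lem:net-approximation-psd`: if `𝓝` is an `ε`-net of `𝓜_k` and
`𝓝⁺` an `ε`-net of `𝓜_k⁺`, `0 < ε < 1/2`, then for every symmetric `A`,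
`sup_{M ∈ 𝓜_k⁺} ⟨A,M⟩ ≤ sup_{N ∈ 𝓝⁺} ⟨A,N⟩ + (2ε/(1-2ε)) sup_{N ∈ 𝓝} ⟨A,N⟩`. -/
theorem sup_inner_psd_le_of_nets
    (n k : ℕ) (ε : ℝ) (hε₀ : 0 < ε) (hε₁ : ε < 1 / 2)
    (N : Set (Matrix (Fin n) (Fin n) ℝ)) (hN : IsNet (MSet n k) N ε)
    (Nplus : Set (Matrix (Fin n) (Fin n) ℝ)) (hNplus : IsNet (MSetPlus n k) Nplus ε)
    (A : Matrix (Fin n) (Fin n) ℝ) (hA : A.IsSymm) :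
    sSup {r : ℝ | ∃ M ∈ MSetPlus n k, r = finner A M} ≤
      sSup {r : ℝ | ∃ M ∈ Nplus, r = finner A M} +
        (2 * ε / (1 - 2 * ε)) * sSup {r : ℝ | ∃ M ∈ N, r = finner A M} := by
  have hplus := sSup_finner_le_of_isNet hε₀ (fun _ h => h.1) ⟨0, zero_mem_MSetPlus n k⟩ hNplus A
  have hfull := sSup_finner_le_of_isNet hε₀ subset_rfl ⟨0, (zero_mem_MSetPlus n k).1⟩ hN A
  have hpos : 0 < 1 - 2 * ε := by linarith
  refine hplus.trans (add_le_add le_rfl ?_)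
  rw [div_mul_eq_mul_div, mul_div_assoc]
  refine mul_le_mul_of_nonneg_left ?_ (by positivity)
  rw [le_div_iff₀ hpos]
  linarith

end
end

section
/- There is a universal constant C such that for every n, every k ≥ 1, and every 0 < ε < 1, the set 𝓜_k of n×n matrices of rank at most k and Frobenius norm at most 1 admits an ε-net (in Frobenius norm) of cardinality at most (C/ε)^{2nk}, and the set 𝓜_k^+ of symmetric positive semidefinite members of 𝓜_k admits an ε-net of cardinality at most (C/ε)^{nk}. -/
open Matrix
open scoped BigOperators

noncomputable section

/-- A `δ`-separated subset of the unit ball of a `d`-dimensional normed space has at most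
`(3 / δ) ^ d` elements. -/
theorem card_le_of_separated_of_norm_le_one {E : Type*} [NormedAddCommGroup E] [NormedSpace ℝ E]
    [FiniteDimensional ℝ E] {δ : ℝ} (hδ : 0 < δ) (hδ1 : δ ≤ 1) (s : Finset E)
    (hs : ∀ c ∈ s, ‖c‖ ≤ 1) (h : ∀ c ∈ s, ∀ d ∈ s, c ≠ d → δ ≤ ‖c - d‖) :
    (s.card : ℝ) ≤ (3 / δ) ^ Module.finrank ℝ E := by
  borelize E
  let μ : MeasureTheory.Measure E := MeasureTheory.Measure.addHaar
  have hr : 0 < δ / 2 := by positivity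
  have hR : 0 < 1 + δ / 2 := by positivity
  have hdisj : (s : Set E).Pairwise
      (Function.onFun Disjoint fun c => Metric.ball c (δ / 2)) := by
    intro c hc d hd hcd
    apply Metric.ball_disjoint_ball
    rw [dist_eq_norm]
    linarith [h c hc d hd hcd]
  have hsub : (⋃ c ∈ s, Metric.ball c (δ / 2)) ⊆ Metric.ball (0 : E) (1 + δ / 2) := by
    refine Set.iUnion₂_subset fun x hx => Metric.ball_subset_ball' ?_
    rw [dist_zero_right]
    linarith [hs x hx]
  have hvol := MeasureTheory.measure_mono (μ := μ) hsub
  rw [MeasureTheory.measure_biUnion_finset hdisj fun c _ => measurableSet_ball,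
    μ.addHaar_ball_of_pos _ hR] at hvol
  simp only [μ.addHaar_ball_of_pos _ hr, Finset.sum_const, nsmul_eq_mul, ← mul_assoc] at hvol
  have hcard := (ENNReal.mul_le_mul_iff_left (Metric.measure_ball_pos _ _ zero_lt_one).ne'
    MeasureTheory.measure_ball_lt_top.ne).1 hvol
  have hreal := ENNReal.toReal_le_of_le_ofReal (pow_nonneg hR.le _) hcard
  rw [ENNReal.toReal_mul, ENNReal.toReal_ofReal (by positivity), ENNReal.toReal_natCast,
    ← le_div_iff₀ (by positivity), ← div_pow] at hreal
  refine hreal.trans (pow_le_pow_left₀ (by positivity) ?_ _)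
  rw [div_le_div_iff₀ hr hδ]
  nlinarith

/-- Any subset of the unit ball of a finite-dimensional normed space has an internal `δ`-net of
cardinality at most `(3 / δ) ^ d`. -/
theorem exists_internal_net {E : Type*} [NormedAddCommGroup E] [NormedSpace ℝ E]
    [FiniteDimensional ℝ E] {δ : ℝ} (hδ : 0 < δ) (hδ1 : δ ≤ 1) (S : Set E)
    (hS : ∀ x ∈ S, ‖x‖ ≤ 1) :
    ∃ N : Finset E, ↑N ⊆ S ∧ (∀ x ∈ S, ∃ y ∈ N, ‖x - y‖ ≤ δ) ∧
      (N.card : ℝ) ≤ (3 / δ) ^ Module.finrank ℝ E := by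
  classical
  let P : Finset E → Prop := fun s =>
    ↑s ⊆ S ∧ ∀ c ∈ s, ∀ d ∈ s, c ≠ d → δ ≤ ‖c - d‖
  have hP (s : Finset E) (hs : P s) : (s.card : ℝ) ≤ (3 / δ) ^ Module.finrank ℝ E :=
    card_le_of_separated_of_norm_le_one hδ hδ1 s (fun c hc => hS c (hs.1 hc)) hs.2
  let T : Set ℕ := {m | ∃ s, P s ∧ s.card = m}
  have hne : T.Nonempty := ⟨0, ∅, by simp [P]⟩
  have hbdd : BddAbove T := by
    refine ⟨⌊(3 / δ) ^ Module.finrank ℝ E⌋₊, ?_⟩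
    rintro _ ⟨s, hs, rfl⟩
    exact Nat.le_floor (hP s hs)
  obtain ⟨N, hN, hNcard⟩ := Nat.sSup_mem hne hbdd
  refine ⟨N, hN.1, fun x hx => ?_, hP N hN⟩
  by_contra! hfar
  have hxN : x ∉ N := fun hxN => by
    have := hfar x hxN
    simp at this
    linarith
  have hins : P (insert x N) := by
    refine ⟨by simpa [Set.insert_subset_iff] using ⟨hx, hN.1⟩, fun c hc d hd hcd => ?_⟩
    rcases Finset.mem_insert.1 hc with rfl | hc' <;>
      rcases Finset.mem_insert.1 hd with rfl | hd'
    · exact absurd rfl hcd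
    · exact (hfar d hd').le
    · rw [norm_sub_rev]
      exact (hfar c hc').le
    · exact hN.2 c hc' d hd' hcd
  have := le_csSup hbdd ⟨_, hins, rfl⟩
  rw [Finset.card_insert_of_notMem hxN, hNcard] at this
  omega

instance fact_one_le_four : Fact ((1 : ENNReal) ≤ 4) := ⟨by norm_num⟩

/-- Families of `k` vectors of `ℝⁿ` with the norm `‖a‖ = (∑ i, ‖a i‖ ^ 4) ^ (1 / 4)`. -/
abbrev VectorFamily (n k : ℕ) : Type := PiLp 4 fun _ : Fin k => EuclideanSpace ℝ (Fin n)

/-- The matrix `∑ i, (a i) (b i)ᵀ`. -/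
def outerSum {n : ℕ} {ι : Type*} [Fintype ι] (a b : ι → EuclideanSpace ℝ (Fin n)) :
    Matrix (Fin n) (Fin n) ℝ :=
  Matrix.of fun p q => ∑ i, a i p * b i q

/-- The members of a family are pairwise orthogonal. -/
def OrthogonalFamilyVec {n : ℕ} {ι : Type*} (a : ι → EuclideanSpace ℝ (Fin n)) : Prop :=
  Pairwise fun i j => inner ℝ (a i) (a j) = 0

theorem VectorFamily.norm_pow_four {n k : ℕ} (a : VectorFamily n k) :
    ‖a‖ ^ 4 = ∑ i, ‖a i‖ ^ 4 := by
  rw [PiLp.norm_eq_of_nat 4 (by norm_num) a, ← Real.rpow_natCast, ← Real.rpow_mul (by positivity)]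
  norm_num

theorem VectorFamily.finrank_eq (n k : ℕ) : Module.finrank ℝ (VectorFamily n k) = n * k := by
  rw [(WithLp.linearEquiv 4 ℝ (Fin k → EuclideanSpace ℝ (Fin n))).finrank_eq,
    Module.finrank_pi_fintype]
  simp [mul_comm]

theorem fnorm_nonneg {n : ℕ} (M : Matrix (Fin n) (Fin n) ℝ) : 0 ≤ fnorm M := Real.sqrt_nonneg _

theorem fnorm_sq {n : ℕ} (M : Matrix (Fin n) (Fin n) ℝ) : fnorm M ^ 2 = ∑ p, ∑ q, M p q ^ 2 := by
  have hM : finner M M = ∑ p, ∑ q, M p q ^ 2 := by simp [finner, sq]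
  rw [fnorm, hM, Real.sq_sqrt (by positivity)]

theorem fnorm_add_le {n : ℕ} (A B : Matrix (Fin n) (Fin n) ℝ) :
    fnorm (A + B) ≤ fnorm A + fnorm B := by
  let := Matrix.frobeniusNormedAddCommGroup (m := Fin n) (n := Fin n) (α := ℝ)
  have key (M : Matrix (Fin n) (Fin n) ℝ) : fnorm M = ‖M‖ := by
    rw [Matrix.frobenius_norm_def, ← Real.sqrt_eq_rpow, fnorm, finner]
    simp [sq]
  simpa only [key] using norm_add_le A B

theorem fnorm_outerSum_sq {n : ℕ} {ι : Type*} [Fintype ι]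
    {a b : ι → EuclideanSpace ℝ (Fin n)}
    (h : OrthogonalFamilyVec a ∨ OrthogonalFamilyVec b) :
    fnorm (outerSum a b) ^ 2 = ∑ i, ‖a i‖ ^ 2 * ‖b i‖ ^ 2 := by
  classical
  have hexp : fnorm (outerSum a b) ^ 2 = ∑ i, ∑ j, inner ℝ (a i) (a j) * inner ℝ (b i) (b j) := by
    rw [fnorm_sq]
    simp only [outerSum, Matrix.of_apply, sq, PiLp.inner_apply, Finset.sum_mul_sum]
    refine (Finset.sum_congr rfl fun p _ => Finset.sum_comm).trans
      (Finset.sum_comm.trans (Finset.sum_congr rfl fun i _ => ?_))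
    refine (Finset.sum_congr rfl fun p _ => Finset.sum_comm).trans
      (Finset.sum_comm.trans ?_)
    refine Finset.sum_congr rfl fun j _ => Finset.sum_congr rfl fun p _ =>
      Finset.sum_congr rfl fun q _ => ?_
    simp
    ring
  rw [hexp]
  refine Finset.sum_congr rfl fun i _ => ?_
  rw [Finset.sum_eq_single i]
  · simp
  · intro j _ hj
    rcases h with h | h <;> simp [h hj.symm]
  · simp

theorem fnorm_outerSum_le {n k : ℕ} {a b : VectorFamily n k}
    (h : OrthogonalFamilyVec a ∨ OrthogonalFamilyVec b) :
    fnorm (outerSum a b) ≤ ‖a‖ * ‖b‖ := by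
  refine le_of_pow_le_pow_left₀ four_ne_zero (by positivity) ?_
  calc fnorm (outerSum a b) ^ 4 = (∑ i, ‖a i‖ ^ 2 * ‖b i‖ ^ 2) ^ 2 := by
        rw [← fnorm_outerSum_sq h]; ring
    _ ≤ (∑ i, (‖a i‖ ^ 2) ^ 2) * ∑ i, (‖b i‖ ^ 2) ^ 2 := Finset.sum_mul_sq_le_sq_mul_sq _ _ _
    _ = (‖a‖ * ‖b‖) ^ 4 := by
        rw [mul_pow, a.norm_pow_four, b.norm_pow_four]
        simp only [← pow_mul]

theorem fnorm_outerSum_sub_le {n k : ℕ} {a a' b b' : VectorFamily n k}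
    (ha' : OrthogonalFamilyVec a') (hb : OrthogonalFamilyVec b) :
    fnorm (outerSum a b - outerSum a' b') ≤ ‖a - a'‖ * ‖b‖ + ‖a'‖ * ‖b - b'‖ := by
  have hsplit : outerSum a b - outerSum a' b' =
      outerSum (a - a').ofLp b + outerSum a' (b - b').ofLp := by
    ext p q
    simp only [outerSum, Matrix.of_apply, Matrix.sub_apply, Matrix.add_apply,
      ← Finset.sum_sub_distrib, ← Finset.sum_add_distrib]
    refine Finset.sum_congr rfl fun i _ => ?_
    simp
    ring
  rw [hsplit]
  exact (fnorm_add_le _ _).trans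
    (add_le_add (fnorm_outerSum_le (.inr hb)) (fnorm_outerSum_le (.inl ha')))

theorem outerSum_eq_mul {n : ℕ} {ι : Type*} [Fintype ι] (a b : ι → EuclideanSpace ℝ (Fin n)) :
    outerSum a b = (Matrix.of fun p i => a i p) * (Matrix.of fun i q => b i q) := by
  ext p q
  simp [outerSum, Matrix.mul_apply]

theorem rank_outerSum_le {n k : ℕ} (a b : Fin k → EuclideanSpace ℝ (Fin n)) :
    (outerSum a b).rank ≤ k := by
  rw [outerSum_eq_mul]
  exact (Matrix.rank_mul_le_left _ _).trans
    ((Matrix.rank_le_card_width _).trans (by simp))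

theorem posSemidef_outerSum_self {n : ℕ} {ι : Type*} [Fintype ι]
    (a : ι → EuclideanSpace ℝ (Fin n)) :
    (outerSum a a).PosSemidef := by
  rw [outerSum_eq_mul]
  exact Matrix.posSemidef_self_mul_conjTranspose (Matrix.of fun p i => a i p)

/-- Families supported on at most `k` indices can be reindexed by `Fin k`. -/
theorem exists_reindex {n k : ℕ} {ι : Type*} [Fintype ι] (s : ι → Prop)
    (hs : Nat.card {i // s i} ≤ k) :
    ∃ T : (ι → EuclideanSpace ℝ (Fin n)) → Fin k → EuclideanSpace ℝ (Fin n),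
      (∀ a, OrthogonalFamilyVec a → OrthogonalFamilyVec (T a)) ∧
      (∀ a b, (∀ i, ‖a i‖ = ‖b i‖) → ∀ j, ‖T a j‖ = ‖T b j‖) ∧
      ∀ a b, (∀ i, ¬ s i → a i = 0) → outerSum (T a) (T b) = outerSum a b := by
  classical
  obtain ⟨f⟩ : Nonempty ({i // s i} ↪ Fin k) :=
    Function.Embedding.nonempty_of_card_le (by simpa [Nat.card_eq_fintype_card] using hs)
  have hval (a : ι → EuclideanSpace ℝ (Fin n)) (i : {i // s i}) :
      Function.extend f (fun i : {i // s i} => a i) 0 (f i) = a i :=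
    f.injective.extend_apply _ _ _
  have hzero (a : ι → EuclideanSpace ℝ (Fin n)) (j : Fin k) (hj : j ∉ Set.range f) :
      Function.extend f (fun i : {i // s i} => a i) 0 j = 0 :=
    Function.extend_apply' _ _ _ hj
  refine ⟨fun a => Function.extend f (fun i : {i // s i} => a i) 0, ?_, ?_, ?_⟩
  · intro a ha j j' hjj'
    by_cases hj : j ∈ Set.range f
    · by_cases hj' : j' ∈ Set.range f
      · obtain ⟨i, rfl⟩ := hj
        obtain ⟨i', rfl⟩ := hj'
        simp only [hval]
        exact ha fun h => hjj' (by rw [Subtype.ext h])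
      · simp only [hzero a j' hj', inner_zero_right]
    · simp only [hzero a j hj, inner_zero_left]
  · intro a b hab j
    by_cases hj : j ∈ Set.range f
    · obtain ⟨i, rfl⟩ := hj
      simp only [hval, hab]
    · simp only [hzero _ j hj]
  · intro a b ha
    ext p q
    simp only [outerSum, Matrix.of_apply]
    rw [← Fintype.sum_of_injective f f.injective (fun i : {i // s i} => a i p * b i q) _
        (fun j hj => by simp [hzero a j hj]) (fun i => by simp only [hval])]
    refine Fintype.sum_of_injective _ Subtype.val_injective _ _ (fun i hi => ?_) fun i => rfl
    have hi' : ¬ s i := by simpa using hi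
    simp [ha i hi']

theorem eq_outerSum_mulVec {n : ℕ} (M : Matrix (Fin n) (Fin n) ℝ)
    (v : OrthonormalBasis (Fin n) ℝ (EuclideanSpace ℝ (Fin n))) :
    outerSum (fun i => WithLp.toLp 2 (M *ᵥ v i)) v = M := by
  ext p q
  have hv (r : Fin n) : ∑ i, v i r * v i q = if r = q then 1 else 0 := by
    have := v.sum_inner_mul_inner (EuclideanSpace.single r 1) (EuclideanSpace.single q 1)
    simpa [EuclideanSpace.inner_single_left, EuclideanSpace.inner_single_right,
      Pi.single_apply, eq_comm] using this
  simp only [outerSum, Matrix.of_apply, Matrix.mulVec, dotProduct, Finset.sum_mul]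
  rw [Finset.sum_comm]
  simp only [mul_assoc, ← Finset.mul_sum, hv]
  simp

theorem exists_orthogonal_factors {n k : ℕ} {M : Matrix (Fin n) (Fin n) ℝ} (hM : M.rank ≤ k) :
    ∃ a b : Fin k → EuclideanSpace ℝ (Fin n), OrthogonalFamilyVec a ∧ OrthogonalFamilyVec b ∧
      (∀ i, ‖a i‖ = ‖b i‖) ∧ outerSum a b = M := by
  have hps := Matrix.posSemidef_conjTranspose_mul_self M
  have hH := hps.isHermitian
  set v := hH.eigenvectorBasis with hv
  set l := hH.eigenvalues with hl
  have hl0 (i) : 0 ≤ l i := hps.eigenvalues_nonneg i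
  have hinner (i j) : inner ℝ (WithLp.toLp 2 (M *ᵥ v i)) (WithLp.toLp 2 (M *ᵥ v j)) =
      l j * inner ℝ (v i) (v j) := by
    have h := hH.mulVec_eigenvectorBasis j
    rw [← hv, ← hl, ← Matrix.mulVec_mulVec] at h
    simp only [EuclideanSpace.inner_eq_star_dotProduct, star_trivial]
    rw [← smul_eq_mul, ← smul_dotProduct, ← h, conjTranspose_eq_transpose_of_trivial,
      Matrix.dotProduct_mulVec, ← Matrix.mulVec_transpose]
  have hinner' (i j) (hij : i ≠ j) : inner ℝ (v i) (v j) = 0 := v.orthonormal.2 hij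
  have hnorm (i) : ‖(WithLp.toLp 2 (M *ᵥ v i) : EuclideanSpace ℝ (Fin n))‖ = √(l i) := by
    rw [norm_eq_sqrt_real_inner, hinner, real_inner_self_eq_norm_sq, v.orthonormal.1]
    simp
  let a : Fin n → EuclideanSpace ℝ (Fin n) := fun i =>
    (√√(l i))⁻¹ • WithLp.toLp 2 (M *ᵥ v i)
  let b : Fin n → EuclideanSpace ℝ (Fin n) := fun i => √√(l i) • v i
  have ha : OrthogonalFamilyVec a := fun i j hij => by
    simp [a, inner_smul_left, inner_smul_right, hinner, hinner' i j hij]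
  have hb : OrthogonalFamilyVec b := fun i j hij => by
    simp [b, inner_smul_left, inner_smul_right, hinner' i j hij]
  have hab (i) : ‖a i‖ = ‖b i‖ := by
    have h1 : ‖a i‖ = (√√(l i))⁻¹ * √(l i) := by
      simp only [a]
      rw [norm_smul, hnorm, Real.norm_of_nonneg (by positivity)]
    have h2 : ‖b i‖ = √√(l i) := by
      simp only [b]
      rw [norm_smul, v.orthonormal.1, Real.norm_of_nonneg (by positivity), mul_one]
    rw [h1, h2, inv_mul_eq_div, Real.div_sqrt]
  have hsum : outerSum a b = M := by
    conv_rhs => rw [← eq_outerSum_mulVec M v]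
    ext p q
    simp only [outerSum, Matrix.of_apply]
    refine Finset.sum_congr rfl fun i _ => ?_
    rcases (hl0 i).eq_or_lt with h0 | h0
    · have hz := hnorm i
      rw [← h0, Real.sqrt_zero, norm_eq_zero] at hz
      have hp : (M *ᵥ v i) p = 0 := by simpa using congrArg (fun x => x p) hz
      simp [a, hp]
    · have : √√(l i) ≠ 0 := by positivity
      simp only [a, b, PiLp.smul_apply, smul_eq_mul]
      field_simp
  have hcard : Nat.card {i // l i ≠ 0} ≤ k := by
    rw [Nat.card_eq_fintype_card, ← hH.rank_eq_card_non_zero_eigs,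
      Matrix.rank_conjTranspose_mul_self]
    exact hM
  obtain ⟨T, hT, hTn, hTs⟩ := exists_reindex (n := n) _ hcard
  refine ⟨T a, T b, hT a ha, hT b hb, hTn a b hab, ?_⟩
  rw [hTs a b fun i hi => ?_, hsum]
  simp [a, not_not.1 hi]

theorem exists_orthogonal_factor_of_posSemidef {n k : ℕ} {M : Matrix (Fin n) (Fin n) ℝ}
    (hM : M.rank ≤ k) (hps : M.PosSemidef) :
    ∃ a : Fin k → EuclideanSpace ℝ (Fin n), OrthogonalFamilyVec a ∧ outerSum a a = M := by
  have hH := hps.isHermitian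
  set v := hH.eigenvectorBasis
  set l := hH.eigenvalues
  have hl0 (i) : 0 ≤ l i := hps.eigenvalues_nonneg i
  let a : Fin n → EuclideanSpace ℝ (Fin n) := fun i => √(l i) • v i
  have ha : OrthogonalFamilyVec a := fun i j hij => by
    simp [a, inner_smul_left, inner_smul_right, v.orthonormal.2 hij]
  have hsum : outerSum a a = M := by
    conv_rhs => rw [← eq_outerSum_mulVec M v]
    ext p q
    simp only [outerSum, Matrix.of_apply]
    refine Finset.sum_congr rfl fun i _ => ?_
    rw [hH.mulVec_eigenvectorBasis i]
    simp only [a, PiLp.smul_apply, smul_eq_mul, Pi.smul_apply]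
    linear_combination (v i p * v i q) * Real.mul_self_sqrt (hl0 i)
  have hcard : Nat.card {i // l i ≠ 0} ≤ k := by
    rw [Nat.card_eq_fintype_card, ← hH.rank_eq_card_non_zero_eigs]
    exact hM
  obtain ⟨T, hT, -, hTs⟩ := exists_reindex (n := n) _ hcard
  refine ⟨T a, hT a ha, ?_⟩
  rw [hTs a a fun i hi => ?_, hsum]
  simp [a, not_not.1 hi]

theorem norm_le_one_of_fnorm_outerSum_le_one {n k : ℕ} {a b : VectorFamily n k}
    (ha : OrthogonalFamilyVec a) (hab : ∀ i, ‖a i‖ = ‖b i‖) (h : fnorm (outerSum a b) ≤ 1) :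
    ‖a‖ ≤ 1 ∧ ‖b‖ ≤ 1 := by
  have hsq : ‖a‖ ^ 4 = fnorm (outerSum a b) ^ 2 := by
    rw [fnorm_outerSum_sq (.inl ha), a.norm_pow_four]
    refine Finset.sum_congr rfl fun i _ => ?_
    rw [← hab]
    ring
  have hba : ‖b‖ ^ 4 = ‖a‖ ^ 4 := by
    simp only [VectorFamily.norm_pow_four, hab]
  have hle : ‖a‖ ^ 4 ≤ 1 := hsq ▸ pow_le_one₀ (fnorm_nonneg _) h
  exact ⟨(pow_le_one_iff_of_nonneg (norm_nonneg _) four_ne_zero).1 hle,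
    (pow_le_one_iff_of_nonneg (norm_nonneg _) four_ne_zero).1 (hba ▸ hle)⟩

/-- Corollary `cor:net-size`: there is a universal constant `C` such that for
all `n`, `k ≥ 1`, `0 < ε < 1`, `𝓜_k` admits an `ε`-net of cardinality at most `(C/ε)^{2nk}`
and `𝓜_k⁺` admits an `ε`-net of cardinality at most `(C/ε)^{nk}`. -/
theorem exists_small_nets :
    ∃ C : ℝ, ∀ n k : ℕ, 1 ≤ k → ∀ ε : ℝ, 0 < ε → ε < 1 →
      (∃ N : Finset (Matrix (Fin n) (Fin n) ℝ),
        IsNet (MSet n k) (↑N) ε ∧ (N.card : ℝ) ≤ (C / ε) ^ (2 * n * k)) ∧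
      (∃ N : Finset (Matrix (Fin n) (Fin n) ℝ),
        IsNet (MSetPlus n k) (↑N) ε ∧ (N.card : ℝ) ≤ (C / ε) ^ (n * k)) := by
  classical
  refine ⟨6, fun n k _ ε hε hε1 => ?_⟩
  obtain ⟨N, hNS, hN, hcard⟩ := exists_internal_net (half_pos hε) (by linarith)
    {a : VectorFamily n k | OrthogonalFamilyVec a ∧ ‖a‖ ≤ 1} fun _ h => h.2
  rw [VectorFamily.finrank_eq, show 3 / (ε / 2) = 6 / ε by field_simp; norm_num] at hcard
  have hmem {a b : VectorFamily n k} (ha : a ∈ N) (hb : b ∈ N) : outerSum a b ∈ MSet n k :=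
    ⟨rank_outerSum_le _ _, (fnorm_outerSum_le (.inl (hNS ha).1)).trans
      (mul_le_one₀ (hNS ha).2 (norm_nonneg _) (hNS hb).2)⟩
  have hclose {a a' b b' : VectorFamily n k} (ha' : a' ∈ N) (hb : OrthogonalFamilyVec b)
      (hb1 : ‖b‖ ≤ 1) (haa' : ‖a - a'‖ ≤ ε / 2) (hbb' : ‖b - b'‖ ≤ ε / 2) :
      fnorm (outerSum a b - outerSum a' b') ≤ ε := by
    refine (fnorm_outerSum_sub_le (hNS ha').1 hb).trans ?_
    have h1 := mul_le_mul haa' hb1 (norm_nonneg _) (by positivity)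
    have h2 := mul_le_mul (hNS ha').2 hbb' (norm_nonneg _) zero_le_one
    linarith
  refine ⟨⟨Finset.image₂ (fun a b : VectorFamily n k => outerSum a b) N N, ⟨?_, ?_⟩, ?_⟩,
    ⟨N.image fun a : VectorFamily n k => outerSum a a, ⟨?_, ?_⟩, ?_⟩⟩
  · intro M hM
    obtain ⟨a, ha, b, hb, rfl⟩ := Finset.mem_image₂.1 hM
    exact hmem ha hb
  · rintro M ⟨hrank, hnorm⟩
    obtain ⟨a, b, ha, hb, hab, rfl⟩ := exists_orthogonal_factors hrank
    obtain ⟨ha1, hb1⟩ := norm_le_one_of_fnorm_outerSum_le_one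
      (a := WithLp.toLp 4 a) (b := WithLp.toLp 4 b) ha hab hnorm
    obtain ⟨a', ha', haa'⟩ := hN (WithLp.toLp 4 a) ⟨ha, ha1⟩
    obtain ⟨b', hb', hbb'⟩ := hN (WithLp.toLp 4 b) ⟨hb, hb1⟩
    exact ⟨_, Finset.mem_image₂_of_mem ha' hb', hclose ha' hb hb1 haa' hbb'⟩
  · calc ((Finset.image₂ (fun a b : VectorFamily n k => outerSum a b) N N).card : ℝ)
        ≤ (N.card : ℝ) * N.card := mod_cast Finset.card_image₂_le _ _ _
      _ ≤ (6 / ε) ^ (n * k) * (6 / ε) ^ (n * k) := by gcongr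
      _ = (6 / ε) ^ (2 * n * k) := by rw [← pow_add]; congr 1; ring
  · intro M hM
    obtain ⟨a, ha, rfl⟩ := Finset.mem_image.1 hM
    exact ⟨hmem ha ha, posSemidef_outerSum_self _⟩
  · rintro M ⟨⟨hrank, hnorm⟩, hps⟩
    obtain ⟨a, ha, rfl⟩ := exists_orthogonal_factor_of_posSemidef hrank hps
    obtain ⟨ha1, -⟩ := norm_le_one_of_fnorm_outerSum_le_one
      (a := WithLp.toLp 4 a) (b := WithLp.toLp 4 a) ha (fun _ => rfl) hnorm
    obtain ⟨a', ha', haa'⟩ := hN (WithLp.toLp 4 a) ⟨ha, ha1⟩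
    exact ⟨_, Finset.mem_image_of_mem _ ha', hclose ha' ha ha1 haa' haa'⟩
  · exact (Nat.cast_le.2 Finset.card_image_le).trans hcard

end
end

section
/- Let a_1 ≥ a_2 ≥ ⋯ ≥ a_N ≥ 0 be a non-increasing sequence of non-negative reals and let ε > 0. If Σ_{i ≥ 2} a_i^3 ≥ ε a_1^3, then (Σ_i a_i^2) ≥ (1 + ε)^{1/3} (Σ_i a_i^3)^{2/3}; that is, ‖a‖_2^2 ≥ (1 + ε)^{1/3} ‖a‖_3^2. -/
open scoped BigOperators

/-- Lemma `lem:l3-l2`: if `a_1 ≥ ⋯ ≥ a_N ≥ 0` and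
`Σ_{i ≥ 2} a_i³ ≥ ε a_1³` for some `ε > 0`, then
`‖a‖₂² ≥ (1+ε)^{1/3} ‖a‖₃²`, i.e. `Σ_i a_i² ≥ (1+ε)^{1/3} (Σ_i a_i³)^{2/3}`. -/
theorem l2_sq_ge_of_l3_spread
    (N : ℕ) (hN : 0 < N) (a : Fin N → ℝ)
    (hmono : Antitone a) (hpos : ∀ i, 0 ≤ a i)
    (ε : ℝ) (hε : 0 < ε)
    (hspread : ε * a ⟨0, hN⟩ ^ 3 ≤ ∑ i ∈ Finset.univ.erase ⟨0, hN⟩, a i ^ 3) :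
    (1 + ε) ^ ((1 : ℝ) / 3) * (∑ i, a i ^ 3) ^ ((2 : ℝ) / 3) ≤ ∑ i, a i ^ 2 := by
  set S := ∑ i, a i ^ 3 with hS
  set Q := ∑ i, a i ^ 2 with hQ
  set m := a ⟨0, hN⟩
  have hS0 : 0 ≤ S := Finset.sum_nonneg fun i _ => pow_nonneg (hpos i) 3
  have hQ0 : 0 ≤ Q := Finset.sum_nonneg fun i _ => sq_nonneg (a i)
  have hmS : (1 + ε) * m ^ 3 ≤ S := by
    rw [hS, ← Finset.add_sum_erase _ _ (Finset.mem_univ (⟨0, hN⟩ : Fin N))]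
    linarith
  have hSQ : S ≤ m * Q := by
    rw [hS, hQ, Finset.mul_sum]
    refine Finset.sum_le_sum fun i _ => ?_
    rw [pow_succ' (a i) 2]
    exact mul_le_mul_of_nonneg_right (hmono (Nat.zero_le i)) (sq_nonneg _)
  rcases hS0.eq_or_lt with h | hSpos
  · rw [← h, Real.zero_rpow (by norm_num), mul_zero]
    exact hQ0
  have hcube : (1 + ε) * S ^ 2 ≤ Q ^ 3 := by
    refine le_of_mul_le_mul_left ?_ hSpos
    calc S * ((1 + ε) * S ^ 2) = (1 + ε) * S ^ 3 := by ring
      _ ≤ (1 + ε) * (m * Q) ^ 3 := by gcongr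
      _ = ((1 + ε) * m ^ 3) * Q ^ 3 := by ring
      _ ≤ S * Q ^ 3 := by gcongr
  refine le_of_pow_le_pow_left₀ three_ne_zero hQ0 ?_
  rw [mul_pow, ← Real.rpow_mul_natCast (by positivity), ← Real.rpow_mul_natCast hS0]
  norm_num
  exact hcube
end
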